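/- arXiv:1705.04205 — 2 statements merged into one kernel-verified Lean document; each statement's English description precedes it below -/
import Mathlib

section
/- Let f : (Fin n → Bool) → Bool and let k < m be nonnegative integers. Suppose there is a family of M₀ pairwise vertex-disjoint (m+1)-tuples, each a chain x₁ ≺ x₂ ≺ ⋯ ≺ x_{m+1} with f(x₁) = true and f(x_i) ≠ f(x_{i+1}) for all 1 ≤ i ≤ m. Then every k-monotone function g : (Fin n → Bool) → Bool satisfies #{x : f(x) ≠ g(x)} ≥ M₀·(m − k)/2, and hence d(f, g) ≥ M₀·(m − k)/2^{n+1}. -/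
/-- A point of the hypercube `{0,1}^n`. -/
abbrev Pt (n : ℕ) := Fin n → Bool

/-- The weight `|x|` of a point: the number of coordinates set to `true`. -/
def wt {n : ℕ} (x : Pt n) : ℕ := (Finset.univ.filter (fun i => x i = true)).card

/-- The partial order `x ≼ y` on the hypercube. -/
def ple {n : ℕ} (x y : Pt n) : Prop := ∀ i, x i ≤ y i

/-- The strict order `x ≺ y` on the hypercube. -/
def plt {n : ℕ} (x y : Pt n) : Prop := ple x y ∧ x ≠ y

/-- `f` is `k`-monotone: there is no chain `x 0 ≺ x 1 ≺ ⋯ ≺ x k` with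
`f (x 0) = true` and `f` alternating along the chain. -/
def IsKMono {n : ℕ} (k : ℕ) (f : Pt n → Bool) : Prop :=
  ¬ ∃ x : ℕ → Pt n, (∀ i < k, plt (x i) (x (i + 1))) ∧ f (x 0) = true ∧
      ∀ i < k, f (x i) ≠ f (x (i + 1))

/-- The normalized Hamming distance `d(f,g)`. -/
noncomputable def hdist {n : ℕ} (f g : Pt n → Bool) : ℝ :=
  ({x : Pt n | f x ≠ g x}.ncard : ℝ) / 2 ^ n

/-- `b : ℕ → ℕ` describes a balanced-blocks partition of `{0,1}^m` into `ℓ` blocks: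
the `i`-th interval of levels (0-indexed) is `I_{i+1} = [b i, b (i+1))`, these intervals
are nonempty and partition `{0,…,m}`, and each block
`B_{i+1} = {y : b i ≤ |y| < b (i+1)}` has size within a `(1 ± ℓ/√m)` factor of `2^m/ℓ`. -/
def IsBBPartition (m ℓ : ℕ) (b : ℕ → ℕ) : Prop :=
  b 0 = 0 ∧ b ℓ = m + 1 ∧ (∀ i < ℓ, b i < b (i + 1)) ∧
  ∀ i < ℓ,
    (1 - ℓ / Real.sqrt m) * 2 ^ m / ℓ ≤
        ({y : Pt m | b i ≤ wt y ∧ wt y < b (i + 1)}.ncard : ℝ) ∧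
    ({y : Pt m | b i ≤ wt y ∧ wt y < b (i + 1)}.ncard : ℝ) ≤
        (1 + ℓ / Real.sqrt m) * 2 ^ m / ℓ

/-- `BB` is the balanced-blocks function associated to the partition `b`:
it is `true` exactly on the blocks `B_i` with `i` odd (1-indexed), i.e. those whose
0-indexed position is even. -/
def IsBBFun (m ℓ : ℕ) (b : ℕ → ℕ) (BB : Pt m → Bool) : Prop :=
  ∀ y : Pt m, BB y = true ↔ ∃ i < ℓ, Even i ∧ b i ≤ wt y ∧ wt y < b (i + 1)

/-- The weight `w` belongs to `MID_L`, i.e. `|w - n_L/2| ≤ √n_L/100`. -/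
def midL (nL w : ℕ) : Prop := |(w : ℝ) - nL / 2| ≤ Real.sqrt nL / 100

/-- The weight of `z` restricted to the first `nL` coordinates (the set `L`). -/
def wL {n : ℕ} (nL : ℕ) (z : Pt n) : ℕ :=
  (Finset.univ.filter (fun i : Fin n => (i : ℕ) < nL ∧ z i = true)).card

/-- The weight of `z` restricted to the coordinates of index `≥ nL` (the set `R`). -/
def wR {n : ℕ} (nL : ℕ) (z : Pt n) : ℕ :=
  (Finset.univ.filter (fun i : Fin n => nL ≤ (i : ℕ) ∧ z i = true)).card

/-- The restriction of `z : Pt n` to the last `nR` coordinates, given `nL + nR = n`. -/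
def yPart {n : ℕ} (nL nR : ℕ) (h : nL + nR = n) (z : Pt n) : Pt nR :=
  fun j => z ⟨nL + (j : ℕ), by have hj := j.isLt; omega⟩

/-- `f` is the hard function built from `BB : Pt nR → Bool`: writing `z = (x,y)` with
`x` the first `nL` coordinates and `y` the last `nR` coordinates, `f z = BB y` when
`|x| ∈ MID_L`, and `f z = false` otherwise. -/
def IsHardFun {n : ℕ} (nL nR : ℕ) (h : nL + nR = n) (BB : Pt nR → Bool)
    (f : Pt n → Bool) : Prop :=
  ∀ z : Pt n,
    (midL nL (wL nL z) → f z = BB (yPart nL nR h z)) ∧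
    (¬ midL nL (wL nL z) → f z = false)

/-- The maximal chain generated by a permutation `σ`: `z_i(j) = decide (σ⁻¹ j < i)`. -/
def chainOf {n : ℕ} (σ : Equiv.Perm (Fin n)) : ℕ → Pt n :=
  fun i j => decide ((σ.symm j : ℕ) < i)

/-- `Z 0 ≺ Z 1 ≺ ⋯ ≺ Z n` is a maximal chain in `{0,1}^n`
(so `Z 0 = 0ⁿ`, `Z n = 1ⁿ` and `|Z i| = i`). -/
def IsFullChain {n : ℕ} (Z : ℕ → Pt n) : Prop :=
  (∀ i < n, plt (Z i) (Z (i + 1))) ∧ ∀ i ≤ n, wt (Z i) = i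

/-- The chain `Z 0 ≺ ⋯ ≺ Z n` contains a violation of `k`-monotonicity of `f`:
some `k+1` of its points form such a violation. -/
def ChainViol {n : ℕ} (k : ℕ) (f : Pt n → Bool) (Z : ℕ → Pt n) : Prop :=
  ∃ t : ℕ → ℕ, (∀ i < k, t i < t (i + 1)) ∧ (∀ i ≤ k, t i ≤ n) ∧
    f (Z (t 0)) = true ∧ ∀ i < k, f (Z (t i)) ≠ f (Z (t (i + 1)))

/-- The probability, over a uniformly random permutation `σ` of `Fin n`
(equivalently, a uniformly random maximal chain `chainOf σ`), of the event `P`. -/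
noncomputable def permProb (n : ℕ) (P : Equiv.Perm (Fin n) → Prop) : ℝ :=
  ({σ : Equiv.Perm (Fin n) | P σ}.ncard : ℝ) / Nat.factorial n

/-- The set `V(Z)`: all `j` such that some point `z = (x,y)` on the chain `Z`
has `|x| ∈ MID_L` and `|y| = j`. -/
def VSet {n : ℕ} (nL : ℕ) (Z : ℕ → Pt n) : Set ℕ :=
  {j | ∃ i ≤ n, midL nL (wL nL (Z i)) ∧ wR nL (Z i) = j}

open Finset in
/-- Reading the sequence `v` greedily, one finds up to each index `i` a subsequence of some
length `c` with values `true, false, true, …`; each missing step is paid for by half a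
disagreement of `v` with `true, false, true, …`. -/
theorem exists_alternating_subsequence (v : ℕ → Bool) (i : ℕ) :
    ∃ (c : ℕ) (t : ℕ → ℕ), (∀ j, j + 1 < c → t j < t (j + 1)) ∧ (∀ j < c, t j ≤ i) ∧
      (∀ j < c, v (t j) = decide (Even j)) ∧ v i = decide (Odd c) ∧
      i + 1 ≤ c + 2 * #{j ∈ range (i + 1) | v j ≠ decide (Even j)} := by
  induction i with
  | zero =>
    cases h : v 0
    · exact ⟨0, id, by simp, by simp, by simp, by simp, by simp [h, filter_singleton]⟩
    · exact ⟨1, fun _ => 0, by simp, by simp, by simp [h], by simp, by simp⟩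
  | succ i ih =>
    obtain ⟨c, t, hlt, hle, hv, hi, hc⟩ := ih
    rw [range_add_one (n := i + 1), filter_insert]
    by_cases hstep : v (i + 1) = decide (Even c)
    · refine ⟨c + 1, Function.update t c (i + 1), fun j hj => ?_, fun j hj => ?_, fun j hj => ?_,
        by rw [hstep]; congr 1; grind, ?_⟩
      · grind
      · grind
      · grind
      · split_ifs
        · rw [card_insert_of_notMem (by simp)]
          omega
        · omega
    · have hodd : v (i + 1) = decide (Odd c) := by grind
      refine ⟨c, t, hlt, fun j hj => (hle j hj).trans i.le_succ, hv, hodd, ?_⟩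
      split_ifs with hne
      · rw [card_insert_of_notMem (by simp)]
        omega
      · have hpar : Odd c ↔ Even (i + 1) := by grind
        grind

theorem plt_iff_lt {n : ℕ} {x y : Pt n} : plt x y ↔ x < y :=
  (lt_iff_le_and_ne (a := x) (b := y)).symm

/-- Alternation from `true` determines `f` along the chain. -/
theorem eq_decide_even_of_alternating {u : ℕ → Bool} {m : ℕ} (h0 : u 0 = true)
    (h : ∀ i < m, u i ≠ u (i + 1)) : ∀ i ≤ m, u i = decide (Even i) := by
  intro i hi
  induction i with
  | zero => simpa using h0
  | succ i ih => grind

open Finset in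
/-- A `k`-monotone function disagrees with an alternating sequence on a chain of `m + 1` points
at least `(m + 1 - k) / 2` times. -/
theorem IsKMono.le_card_disagreements {n k m : ℕ} {f g : Pt n → Bool} (hg : IsKMono k g)
    {X : ℕ → Pt n} (hX : StrictMonoOn X (Set.Iic m)) (h0 : f (X 0) = true)
    (hf : ∀ i < m, f (X i) ≠ f (X (i + 1))) :
    m + 1 ≤ k + 2 * #{i ∈ range (m + 1) | f (X i) ≠ g (X i)} := by
  obtain ⟨c, t, hlt, hle, hv, -, hc⟩ := exists_alternating_subsequence (fun i => g (X i)) m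
  have hck : c ≤ k := by
    by_contra! hkc
    refine hg ⟨fun j => X (t j), fun i hi => plt_iff_lt.2 ?_, by simpa using hv 0 (by omega),
      fun i hi => ?_⟩
    · exact hX (hle i (by omega)) (hle (i + 1) (by omega)) (hlt i (by omega))
    · rw [hv i (by omega), hv (i + 1) (by omega)]
      grind
  have heq : #{i ∈ range (m + 1) | g (X i) ≠ decide (Even i)} =
      #{i ∈ range (m + 1) | f (X i) ≠ g (X i)} := by
    congr 1
    refine filter_congr fun i hi => ?_
    rw [← eq_decide_even_of_alternating (u := fun i => f (X i)) h0 hf i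
      (by simpa [Nat.lt_succ_iff] using hi), ne_comm]
  omega

/-- Suppose `k < m` and there is a family of `M₀` pairwise vertex-disjoint
`(m+1)`-tuples, each a chain `x₁ ≺ ⋯ ≺ x_{m+1}` with `f x₁ = true` and `f` alternating.
Then every `k`-monotone `g` satisfies `#{x : f x ≠ g x} ≥ M₀·(m − k)/2`, and hence
`d(f, g) ≥ M₀·(m − k)/2^{n+1}`. -/
theorem stmt10 (n : ℕ) (f : Pt n → Bool) (k m M₀ : ℕ) (hkm : k < m)
    (T : Fin M₀ → ℕ → Pt n)
    (hT : ∀ a : Fin M₀,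
      (∀ i < m, plt (T a i) (T a (i + 1))) ∧ f (T a 0) = true ∧
        ∀ i < m, f (T a i) ≠ f (T a (i + 1)))
    (hdisj : ∀ a a' : Fin M₀, a ≠ a' → ∀ i j, i ≤ m → j ≤ m → T a i ≠ T a' j)
    (g : Pt n → Bool) (hg : IsKMono k g) :
    (M₀ : ℝ) * ((m : ℝ) - k) / 2 ≤ ({x : Pt n | f x ≠ g x}.ncard : ℝ) ∧
    (M₀ : ℝ) * ((m : ℝ) - k) / 2 ^ (n + 1) ≤ hdist f g := by
  have hmono : ∀ a, StrictMonoOn (T a) (Set.Iic m) := fun a =>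
    strictMonoOn_of_lt_add_one Set.ordConnected_Iic fun i _ _ hi =>
      plt_iff_lt.1 ((hT a).1 i (by simpa [Nat.succ_le_iff] using hi))
  have hcount : M₀ * (m + 1) ≤ M₀ * k + 2 * {x : Pt n | f x ≠ g x}.ncard := by
    let S (a : Fin M₀) : Finset ℕ :=
      {i ∈ Finset.range (m + 1) | f (T a i) ≠ g (T a i)}
    have hinj : ∑ a, (S a).card ≤ {x : Pt n | f x ≠ g x}.ncard := by
      rw [← Finset.card_sigma, ← Set.ncard_coe_finset]
      refine Set.ncard_le_ncard_of_injOn (fun p => T p.1 p.2) ?_ ?_ (Set.toFinite _)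
      · rintro ⟨a, i⟩ h
        simp only [S, Finset.coe_sigma, Set.mem_sigma_iff, Finset.mem_coe,
          Finset.mem_filter] at h
        exact h.2.2
      · rintro ⟨a, i⟩ h ⟨a', j⟩ h' heq
        simp only [S, Finset.coe_sigma, Set.mem_sigma_iff, Finset.mem_coe,
          Finset.mem_filter, Finset.mem_range, Nat.lt_succ_iff] at h h'
        by_cases haa : a = a'
        · subst haa
          rw [(hmono a).injOn h.2.1 h'.2.1 heq]
        · exact absurd heq (hdisj a a' haa i j h.2.1 h'.2.1)
    have hsum := Finset.sum_le_sum fun a (_ : a ∈ Finset.univ) =>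
      hg.le_card_disagreements (hmono a) (hT a).2.1 (hT a).2.2
    simp only [Finset.sum_add_distrib, ← Finset.mul_sum, Finset.sum_const, Finset.card_univ,
      Fintype.card_fin, smul_eq_mul] at hsum
    change _ ≤ _ + 2 * ∑ a, (S a).card at hsum
    linarith
  have hmain : (M₀ : ℝ) * ((m : ℝ) - k) / 2 ≤ ({x : Pt n | f x ≠ g x}.ncard : ℝ) := by
    have hreal : (M₀ : ℝ) * (m + 1) ≤ M₀ * k + 2 * ({x : Pt n | f x ≠ g x}.ncard : ℝ) :=
      mod_cast hcount
    linarith [(Nat.cast_nonneg M₀ : (0 : ℝ) ≤ M₀)]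
  refine ⟨hmain, ?_⟩
  rw [hdist, pow_succ', ← div_div]
  gcongr
end

section
/- Let BB be the balanced-blocks function associated to a balanced-blocks partition of {0,1}^m into ℓ blocks with intervals I₁, …, I_ℓ, and let k ≥ 1. If x₁ ≺ x₂ ≺ ⋯ ≺ x_{k+1} is a violation of k-monotonicity of BB (i.e., BB(x₁) = true and BB(x_i) ≠ BB(x_{i+1}) for all 1 ≤ i ≤ k), then |x_{k+1}| − |x₁| ≥ (k − 1)·min_{1 ≤ i ≤ ℓ} |I_i|. -/
theorem wt_le_of_ple {n : ℕ} {x y : Pt n} (h : ple x y) : wt x ≤ wt y := by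
  refine Finset.card_le_card fun i hi => ?_
  simp only [Finset.mem_filter, Finset.mem_univ, true_and] at hi ⊢
  exact Bool.eq_true_of_true_le (hi ▸ h i)

theorem wt_le {n : ℕ} (x : Pt n) : wt x ≤ n := by
  simpa [wt] using Finset.card_filter_le (Finset.univ : Finset (Fin n)) (fun i => x i = true)

theorem mono_of_lt_succ {b : ℕ → ℕ} {ℓ i j : ℕ} (h : ∀ i < ℓ, b i < b (i + 1))
    (hij : i ≤ j) (hj : j ≤ ℓ) : b i ≤ b j := by
  induction j, hij using Nat.le_induction with
  | base => exact le_rfl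
  | succ j _ ih => exact (ih (by omega)).trans (h j (by omega)).le

/-- Every level below `b ℓ` lies in one of the intervals `[b j, b (j + 1))`. -/
theorem exists_block {b : ℕ → ℕ} {ℓ w : ℕ} (h0 : b 0 = 0) (hw : w < b ℓ) :
    ∃ j < ℓ, b j ≤ w ∧ w < b (j + 1) := by
  induction ℓ with
  | zero => omega
  | succ ℓ ih =>
    by_cases h : w < b ℓ
    · obtain ⟨j, hj, hjw⟩ := ih h
      exact ⟨j, by omega, hjw⟩
    · exact ⟨ℓ, by omega, by omega, hw⟩

theorem IsBBFun.eq_true_iff_even {m ℓ j : ℕ} {b : ℕ → ℕ} {BB : Pt m → Bool}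
    (hBB : IsBBFun m ℓ b BB) (h : ∀ i < ℓ, b i < b (i + 1)) {y : Pt m}
    (hj : j < ℓ) (hl : b j ≤ wt y) (hu : wt y < b (j + 1)) : BB y = true ↔ Even j := by
  rw [hBB y]
  refine ⟨?_, fun he => ⟨j, hj, he, hl, hu⟩⟩
  rintro ⟨i, hi, he, hil, hiu⟩
  rcases lt_trichotomy i j with hij | rfl | hij
  · have := mono_of_lt_succ h (i := i + 1) (j := j) hij hj.le
    omega
  · exact he
  · have := mono_of_lt_succ h (i := j + 1) (j := i) hij hi.le
    omega

/-- If `x ≼ y` and `BB x ≠ BB y`, then `y` lies in a strictly later block than `x`. -/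
theorem exists_later_block {m ℓ j : ℕ} {b : ℕ → ℕ} {BB : Pt m → Bool}
    (hb : IsBBPartition m ℓ b) (hBB : IsBBFun m ℓ b BB) {x y : Pt m} (hxy : ple x y)
    (hne : BB x ≠ BB y) (hj : j < ℓ) (hl : b j ≤ wt x) (hu : wt x < b (j + 1)) :
    ∃ i < ℓ, b (j + 1) ≤ b i ∧ b i ≤ wt y ∧ wt y < b (i + 1) := by
  obtain ⟨h0, hℓ, h, -⟩ := hb
  obtain ⟨i, hi, hil, hiu⟩ := exists_block (ℓ := ℓ) h0
    (show wt y < b ℓ by have := wt_le y; omega)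
  refine ⟨i, hi, ?_, hil, hiu⟩
  have hw := wt_le_of_ple hxy
  rcases lt_trichotomy i j with hij | rfl | hij
  · have := mono_of_lt_succ h (i := i + 1) (j := j) hij hj.le
    omega
  · exact absurd (Bool.eq_iff_iff.mpr ((hBB.eq_true_iff_even h hj hl hu).trans
      (hBB.eq_true_iff_even h hi hil hiu).symm)) hne
  · exact mono_of_lt_succ h hij hi.le

/-- If `BB` is the balanced-blocks function of a partition of `{0,1}^m`
into `ℓ` blocks with intervals `I_i = [b (i-1), b i)`, `k ≥ 1`, and `x 0 ≺ ⋯ ≺ x k`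
is a violation of `k`-monotonicity of `BB`, then
`|x k| − |x 0| ≥ (k − 1)·min_i |I_i|`. -/
theorem stmt11 (m ℓ k : ℕ) (hk : 1 ≤ k) (b : ℕ → ℕ) (BB : Pt m → Bool)
    (hb : IsBBPartition m ℓ b) (hBB : IsBBFun m ℓ b BB)
    (x : ℕ → Pt m)
    (hchain : ∀ i < k, plt (x i) (x (i + 1)))
    (hx0 : BB (x 0) = true)
    (halt : ∀ i < k, BB (x i) ≠ BB (x (i + 1))) :
    (k - 1) * sInf {d : ℕ | ∃ i < ℓ, d = b (i + 1) - b i} ≤ wt (x k) - wt (x 0) := by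
  set M := sInf {d : ℕ | ∃ i < ℓ, d = b (i + 1) - b i}
  have hM : ∀ i < ℓ, b i + M ≤ b (i + 1) := fun i hi => by
    have h₁ : M ≤ b (i + 1) - b i := Nat.sInf_le ⟨i, hi, rfl⟩
    have h₂ := hb.2.2.1 i hi
    omega
  have key : ∀ i ≤ k, ∃ j < ℓ, b j ≤ wt (x i) ∧ wt (x i) < b (j + 1) ∧
      wt (x 0) + i * M < b (j + 1) := by
    intro i
    induction i with
    | zero =>
      intro _
      obtain ⟨j, hj, -, hl, hu⟩ := (hBB (x 0)).mp hx0
      exact ⟨j, hj, hl, hu, by simpa using hu⟩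
    | succ i ih =>
      intro hi
      obtain ⟨j, hj, hl, hu, hlt⟩ := ih (by omega)
      obtain ⟨j', hj', hle, hl', hu'⟩ :=
        exists_later_block hb hBB (hchain i hi).1 (halt i hi) hj hl hu
      have := hM j' hj'
      exact ⟨j', hj', hl', hu', by rw [add_one_mul]; omega⟩
  obtain ⟨i, rfl⟩ : ∃ i, k = i + 1 := ⟨k - 1, by omega⟩
  obtain ⟨j, hj, hl, hu, hlt⟩ := key i (by omega)
  obtain ⟨j', -, hle, hl', -⟩ :=
    exists_later_block hb hBB (hchain i (by omega)).1 (halt i (by omega)) hj hl hu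
  rw [Nat.add_sub_cancel]
  omega
end
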